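/- arXiv:1612.08686 — 6 statements merged into one kernel-verified Lean document; each statement's English description precedes it below -/
import Mathlib

section
/- Let ι be a nonempty finite index set, κ a finite index set, a ∈ ι, and let m, d, G ∈ ℝ, K : ι → ℝ, B : κ → ℝ, u : ι → ℝ, ū : κ → ℝ. Assume: (i) m > 0; (ii) the row equation m·d + Σ_{b∈ι} K(b)·u(b) − Σ_{c∈κ} B(c)·ū(c) = G holds; (iii) K(b) ≤ 0 for every b ≠ a; (iv) B(c) ≥ 0 for every c ∈ κ; (v) Σ_{b∈ι} K(b) = Σ_{c∈κ} B(c); (vi) u has a discrete maximum at a relative to ū; and (vii) G ≤ 0. Then d ≤ 0. -/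
/-- A vector `u : ι → ℝ` has a discrete maximum at `a` relative to boundary data `uBar`. -/
def IsDiscreteMax {ι κ : Type*} (u : ι → ℝ) (uBar : κ → ℝ) (a : ι) : Prop :=
  (∀ b, u b ≤ u a) ∧ (∀ c, uBar c ≤ u a)

/-- LED (maximum case): the algebraic core of Theorem 3.4. -/
theorem led_max {ι κ : Type*} [Fintype ι] [Nonempty ι] [Fintype κ]
    (a : ι) (m d G : ℝ) (K : ι → ℝ) (B : κ → ℝ) (u : ι → ℝ) (uBar : κ → ℝ)
    (hm : 0 < m)
    (hrow : m * d + ∑ b, K b * u b - ∑ c, B c * uBar c = G)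
    (hK : ∀ b, b ≠ a → K b ≤ 0)
    (hB : ∀ c, 0 ≤ B c)
    (hsum : ∑ b, K b = ∑ c, B c)
    (hmax : IsDiscreteMax u uBar a)
    (hG : G ≤ 0) :
    d ≤ 0 := by
  obtain ⟨hu, huBar⟩ := hmax
  have hKu : ∑ b, K b * u a ≤ ∑ b, K b * u b := by
    refine Finset.sum_le_sum fun b _ => ?_
    rcases eq_or_ne b a with rfl | hb
    · exact le_rfl
    · exact mul_le_mul_of_nonpos_left (hu b) (hK b hb)
  have hBu : ∑ c, B c * uBar c ≤ ∑ c, B c * u a :=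
    Finset.sum_le_sum fun c _ => mul_le_mul_of_nonneg_left (huBar c) (hB c)
  rw [← Finset.sum_mul] at hKu hBu
  rw [hsum] at hKu
  exact nonpos_of_mul_nonpos_right (by linarith) hm
end

section
/- Let ι be a nonempty finite index set, κ a finite index set, a ∈ ι, and let m, d, G ∈ ℝ, K : ι → ℝ, B : κ → ℝ, u : ι → ℝ, ū : κ → ℝ. Assume: (i) m > 0; (ii) the row equation m·d + Σ_{b∈ι} K(b)·u(b) − Σ_{c∈κ} B(c)·ū(c) = G holds; (iii) K(b) ≤ 0 for every b ≠ a; (iv) B(c) ≥ 0 for every c ∈ κ; (v) Σ_{b∈ι} K(b) = Σ_{c∈κ} B(c); (vi) u has a discrete minimum at a relative to ū; and (vii) G ≥ 0. Then d ≥ 0. -/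
/-- A vector `u : ι → ℝ` has a discrete minimum at `a` relative to boundary data `uBar`. -/
def IsDiscreteMin {ι κ : Type*} (u : ι → ℝ) (uBar : κ → ℝ) (a : ι) : Prop :=
  (∀ b, u a ≤ u b) ∧ (∀ c, u a ≤ uBar c)

/-- LED (minimum case): the algebraic core of Theorem 3.4. -/
theorem led_min {ι κ : Type*} [Fintype ι] [Nonempty ι] [Fintype κ]
    (a : ι) (m d G : ℝ) (K : ι → ℝ) (B : κ → ℝ) (u : ι → ℝ) (uBar : κ → ℝ)
    (hm : 0 < m)
    (hrow : m * d + ∑ b, K b * u b - ∑ c, B c * uBar c = G)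
    (hK : ∀ b, b ≠ a → K b ≤ 0)
    (hB : ∀ c, 0 ≤ B c)
    (hsum : ∑ b, K b = ∑ c, B c)
    (hmin : IsDiscreteMin u uBar a)
    (hG : 0 ≤ G) :
    0 ≤ d := by
  have hKu : ∑ b, K b * u b ≤ ∑ b, K b * u a := by
    refine Finset.sum_le_sum fun b _ => ?_
    by_cases hb : b = a
    · rw [hb]
    · exact mul_le_mul_of_nonpos_left (hmin.1 b) (hK b hb)
  have hBu : ∑ c, B c * u a ≤ ∑ c, B c * uBar c :=
    Finset.sum_le_sum fun c _ => mul_le_mul_of_nonneg_left (hmin.2 c) (hB c)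
  rw [← Finset.sum_mul, hsum] at hKu
  rw [← Finset.sum_mul] at hBu
  exact nonneg_of_mul_nonneg_right (by linarith : 0 ≤ m * d) hm
end

section
/- Let ι be a nonempty finite index set, κ a finite index set, a ∈ ι, and let K : ι → ℝ, B : κ → ℝ, u : ι → ℝ, ū : κ → ℝ. Assume: (i) K(b) ≤ 0 for every b ≠ a; (ii) B(c) ≥ 0 for every c ∈ κ; (iii) Σ_{b∈ι} K(b) = Σ_{c∈κ} B(c); (iv) K(a) > 0; (v) Σ_{b∈ι} K(b)·u(b) = Σ_{c∈κ} B(c)·ū(c); and (vi) u has a discrete maximum at a relative to ū. Then either there exists b ≠ a with K(b) < 0 and u(b) = u(a), or there exists c ∈ κ with B(c) > 0 and ū(c) = u(a). -/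
/-- Induction step in the proof of Theorem 3.6: a discrete maximum that is a nontrivial
convex combination of neighbors and boundary values must be attained at a neighbor or
boundary node actively coupled to `a`. -/
theorem dmp_induction_step {ι κ : Type*} [Fintype ι] [Nonempty ι] [Fintype κ]
    (a : ι) (K : ι → ℝ) (B : κ → ℝ) (u : ι → ℝ) (uBar : κ → ℝ)
    (hK : ∀ b, b ≠ a → K b ≤ 0)
    (hB : ∀ c, 0 ≤ B c)
    (hsum : ∑ b, K b = ∑ c, B c)
    (hKa : 0 < K a)
    (hrow : ∑ b, K b * u b = ∑ c, B c * uBar c)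
    (hmax : IsDiscreteMax u uBar a) :
    (∃ b, b ≠ a ∧ K b < 0 ∧ u b = u a) ∨ (∃ c, 0 < B c ∧ uBar c = u a) := by
  obtain ⟨hu, hbar⟩ := hmax
  have hle : ∀ b ∈ Finset.univ, K b * (u a - u b) ≤ 0 := by
    intro b _
    by_cases hb : b = a
    · simp [hb]
    · exact mul_nonpos_of_nonpos_of_nonneg (hK b hb) (sub_nonneg.2 (hu b))
  have hge : ∀ c ∈ Finset.univ, 0 ≤ B c * (u a - uBar c) :=
    fun c _ => mul_nonneg (hB c) (sub_nonneg.2 (hbar c))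
  have heq : ∑ b, K b * (u a - u b) = ∑ c, B c * (u a - uBar c) := by
    simp only [mul_sub, Finset.sum_sub_distrib, ← Finset.sum_mul, hsum, hrow]
  have hK_zero := (Finset.sum_eq_zero_iff_of_nonpos hle).1
    (le_antisymm (Finset.sum_nonpos hle) (heq ▸ Finset.sum_nonneg hge))
  have hB_zero := (Finset.sum_eq_zero_iff_of_nonneg hge).1
    (le_antisymm (heq ▸ Finset.sum_nonpos hle) (Finset.sum_nonneg hge))
  by_cases hpos : ∃ c, 0 < B c
  · obtain ⟨c, hc⟩ := hpos
    refine Or.inr ⟨c, hc, ?_⟩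
    have := (mul_eq_zero.1 (hB_zero c (Finset.mem_univ c))).resolve_left hc.ne'
    linarith
  · push Not at hpos
    have hsum_nonpos : ∑ b, K b ≤ 0 := hsum ▸ Finset.sum_nonpos fun c _ => hpos c
    obtain ⟨b, hb⟩ : ∃ b, K b < 0 := by
      by_contra! hnonneg
      have := Finset.single_le_sum (fun b _ => hnonneg b) (Finset.mem_univ a)
      linarith
    refine Or.inl ⟨b, fun h => ?_, hb, ?_⟩
    · subst h
      linarith
    · have := (mul_eq_zero.1 (hK_zero b (Finset.mem_univ b))).resolve_left hb.ne
      linarith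
end

section
/- Let E be a real normed vector space, let u : E → ℝ be an affine map, let x_a, x_b ∈ E with x_b ≠ x_a, let t > 0, and set x_sym := x_a − t·(x_b − x_a). Then (u(x_b) − u(x_a))/‖x_b − x_a‖ + (u(x_sym) − u(x_a))/‖x_sym − x_a‖ = 0. -/
/-- Core of Lemma 4.7 (linearity preservation): for an affine function `u`, the gradient
jump across a node pair and its symmetric point vanishes. -/
theorem affine_gradient_jump_vanishes {E : Type*} [NormedAddCommGroup E] [NormedSpace ℝ E]
    (u : E →ᵃ[ℝ] ℝ) (xa xb : E) (hne : xb ≠ xa) (t : ℝ) (ht : 0 < t) :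
    (u xb - u xa) / ‖xb - xa‖ +
      (u (xa - t • (xb - xa)) - u xa) / ‖(xa - t • (xb - xa)) - xa‖ = 0 := by
  have hu (x y : E) : u x - u y = u.linear (x - y) := (u.linearMap_vsub x y).symm
  have hsym : xa - t • (xb - xa) - xa = -(t • (xb - xa)) := by abel
  have hnorm : ‖xb - xa‖ ≠ 0 := norm_ne_zero_iff.mpr (sub_ne_zero.mpr hne)
  rw [hu, hu, hsym, norm_neg, norm_smul, Real.norm_of_nonneg ht.le, map_neg, map_smul,
    smul_eq_mul]
  field_simp
  ring
end

section
/- Let τ > 0 and γ ≥ 0. Let β be a finite index set, v, w : β → ℝ, and r, s : β → ℝ with r(b) > 0 and s(b) > 0 for all b ∈ β. Define J := Σ_{b∈β} (v(b)/r(b) + w(b)/s(b)) and D_low := Σ_{b∈β} ( (v(b)²/√(v(b)² + τ))/r(b) + (w(b)²/√(w(b)² + τ))/s(b) ). Assume that either v(b) ≤ 0 and w(b) ≤ 0 for all b, or v(b) ≥ 0 and w(b) ≥ 0 for all b, and that D_low + γ > 0. Then (√(J² + τ) + γ) / (D_low + γ) > 1. -/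
theorem sq_div_sqrt_sq_add_le_abs {τ : ℝ} (hτ : 0 < τ) (x : ℝ) :
    x ^ 2 / Real.sqrt (x ^ 2 + τ) ≤ |x| := by
  have h : |x| ≤ Real.sqrt (x ^ 2 + τ) := Real.abs_le_sqrt (by linarith)
  rw [div_le_iff₀ (Real.sqrt_pos.2 (by positivity))]
  calc x ^ 2 = |x| * |x| := by rw [abs_mul_abs_self, sq]
    _ ≤ |x| * Real.sqrt (x ^ 2 + τ) := by gcongr

theorem abs_lt_sqrt_sq_add {τ : ℝ} (hτ : 0 < τ) (x : ℝ) :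
    |x| < Real.sqrt (x ^ 2 + τ) :=
  Real.lt_sqrt_of_sq_lt (by rw [sq_abs]; linarith)

/-- Section 6: the smoothed detector quotient
`ζ = (√(J² + τ) + γ)/(D_low + γ)` is strictly greater than 1 at local discrete extrema
(all nodal differences of one sign). -/
theorem smoothed_detector_gt_one_at_extrema (τ γ : ℝ) (hτ : 0 < τ) (hγ : 0 ≤ γ)
    {β : Type*} [Fintype β] (v w r s : β → ℝ)
    (hr : ∀ b, 0 < r b) (hs : ∀ b, 0 < s b)
    (hsign : ((∀ b, v b ≤ 0) ∧ (∀ b, w b ≤ 0)) ∨ ((∀ b, 0 ≤ v b) ∧ (∀ b, 0 ≤ w b)))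
    (hden : 0 < (∑ b, (v b ^ 2 / Real.sqrt (v b ^ 2 + τ) / r b +
        w b ^ 2 / Real.sqrt (w b ^ 2 + τ) / s b)) + γ) :
    1 < (Real.sqrt ((∑ b, (v b / r b + w b / s b)) ^ 2 + τ) + γ) /
        ((∑ b, (v b ^ 2 / Real.sqrt (v b ^ 2 + τ) / r b +
          w b ^ 2 / Real.sqrt (w b ^ 2 + τ) / s b)) + γ) := by
  rw [one_lt_div hden]
  have hle : ∑ b, (v b ^ 2 / Real.sqrt (v b ^ 2 + τ) / r b +
      w b ^ 2 / Real.sqrt (w b ^ 2 + τ) / s b) ≤ ∑ b, (|v b| / r b + |w b| / s b) := by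
    refine Finset.sum_le_sum fun b _ => add_le_add ?_ ?_
    · exact div_le_div_of_nonneg_right (sq_div_sqrt_sq_add_le_abs hτ _) (hr b).le
    · exact div_le_div_of_nonneg_right (sq_div_sqrt_sq_add_le_abs hτ _) (hs b).le
  have habs : ∑ b, (|v b| / r b + |w b| / s b) ≤ |∑ b, (v b / r b + w b / s b)| := by
    rcases hsign with ⟨hv, hw⟩ | ⟨hv, hw⟩
    · simp only [abs_of_nonpos (hv _), abs_of_nonpos (hw _), neg_div, ← neg_add,
        Finset.sum_neg_distrib]
      exact neg_le_abs _
    · simp only [abs_of_nonneg (hv _), abs_of_nonneg (hw _)]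
      exact le_abs_self _
  linarith [abs_lt_sqrt_sq_add hτ (∑ b, (v b / r b + w b / s b))]
end

section
/- Let n ≥ 1, let q ∈ ℕ with q ≥ 1, and fix j ∈ {1,…,n}. Define f : ℝⁿ → ℝ by f(x) := (|Σ_{i=1}^n x_i| / Σ_{i=1}^n |x_i|)^q · x_j for x ≠ 0 and f(0) := 0. Then f is Lipschitz continuous on ℝⁿ. -/
open scoped NNReal

/-- On `[0, 1]` the map `a ↦ a ^ q` is Lipschitz with constant `q`. -/
lemma abs_pow_sub_pow_le_mul_of_mem_Icc {a b : ℝ} (ha : a ∈ Set.Icc (0 : ℝ) 1)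
    (hb : b ∈ Set.Icc (0 : ℝ) 1) (q : ℕ) : |a ^ q - b ^ q| ≤ q * |a - b| := by
  have hmax : max |a| |b| ^ (q - 1) ≤ 1 := by
    refine pow_le_one₀ (le_max_of_le_left (abs_nonneg a)) (max_le ?_ ?_)
    · exact (abs_of_nonneg ha.1).trans_le ha.2
    · exact (abs_of_nonneg hb.1).trans_le hb.2
  calc |a ^ q - b ^ q| ≤ |a - b| * q * max |a| |b| ^ (q - 1) := abs_pow_sub_pow_le a b q
    _ ≤ |a - b| * q * 1 := by gcongr
    _ = q * |a - b| := by ring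

section SumRatio

variable {ι : Type*} [Fintype ι]

lemma abs_sum_div_sum_abs_mem_Icc (x : ι → ℝ) :
    |∑ i, x i| / ∑ i, |x i| ∈ Set.Icc (0 : ℝ) 1 :=
  ⟨by positivity, div_le_one_of_le₀ (Finset.abs_sum_le_sum_abs _ _) (by positivity)⟩

lemma abs_sum_div_sum_abs_mul_sum_abs (x : ι → ℝ) :
    (|∑ i, x i| / ∑ i, |x i|) * ∑ i, |x i| = |∑ i, x i| :=
  div_mul_cancel_of_imp fun h =>
    le_antisymm ((Finset.abs_sum_le_sum_abs _ _).trans_eq h) (abs_nonneg _)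

lemma sum_abs_sub_le_card_mul_dist (x y : ι → ℝ) :
    ∑ i, |x i - y i| ≤ Fintype.card ι * dist x y := by
  calc ∑ i, |x i - y i| ≤ ∑ _i : ι, dist x y :=
        Finset.sum_le_sum fun i _ => dist_le_pi_dist x y i
    _ = Fintype.card ι * dist x y := by simp

/-- The ratio `|∑ x i| / ∑ |x i|` varies slowly away from the origin. -/
lemma abs_ratio_sub_ratio_mul_sum_abs_le (x y : ι → ℝ) :
    |(|∑ i, x i| / ∑ i, |x i|) - (|∑ i, y i| / ∑ i, |y i|)| * ∑ i, |x i|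
      ≤ 2 * ∑ i, |x i - y i| := by
  have hx := abs_sum_div_sum_abs_mul_sum_abs x
  have hy := abs_sum_div_sum_abs_mul_sum_abs y
  obtain ⟨hr0, hr1⟩ := abs_sum_div_sum_abs_mem_Icc y
  set r := |∑ i, x i| / ∑ i, |x i|
  set s := |∑ i, y i| / ∑ i, |y i|
  have hS : |(|∑ i, x i| - |∑ i, y i|)| ≤ ∑ i, |x i - y i| := by
    refine (abs_abs_sub_abs_le _ _).trans ?_
    rw [← Finset.sum_sub_distrib]
    exact Finset.abs_sum_le_sum_abs _ _
  have hN : |(∑ i, |y i|) - (∑ i, |x i|)| ≤ ∑ i, |x i - y i| := by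
    rw [abs_sub_comm, ← Finset.sum_sub_distrib]
    exact (Finset.abs_sum_le_sum_abs _ _).trans
      (Finset.sum_le_sum fun i _ => abs_abs_sub_abs_le _ _)
  calc |r - s| * ∑ i, |x i| = |(r - s) * (∑ i, |x i|)| := by
        rw [abs_mul, abs_of_nonneg (Finset.sum_nonneg fun i _ => abs_nonneg (x i))]
    _ = |(|∑ i, x i| - |∑ i, y i|) + s * ((∑ i, |y i|) - ∑ i, |x i|)| := by
        rw [← hx, ← hy]; ring_nf
    _ ≤ |(|∑ i, x i| - |∑ i, y i|)| + s * |(∑ i, |y i|) - (∑ i, |x i|)| := by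
        refine (abs_add_le _ _).trans_eq ?_
        rw [abs_mul s, abs_of_nonneg hr0]
    _ ≤ (∑ i, |x i - y i|) + 1 * ∑ i, |x i - y i| := by gcongr
    _ = 2 * ∑ i, |x i - y i| := by ring

end SumRatio

/-- Key supporting fact in the proof of Theorem 5.1: the shock detector
`α(x) = (|∑ i, x i| / ∑ i, |x i|)^q` times a coordinate is globally Lipschitz on `ℝⁿ`. -/
theorem shock_detector_times_coordinate_lipschitz
    (n : ℕ) (hn : 1 ≤ n) (q : ℕ) (hq : 1 ≤ q) (j : Fin n) :
    ∃ C : ℝ≥0, LipschitzWith C (fun x : Fin n → ℝ =>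
      if x = 0 then 0 else (|∑ i, x i| / ∑ i, |x i|) ^ q * x j) := by
  have hf : (fun x : Fin n → ℝ =>
      if x = 0 then 0 else (|∑ i, x i| / ∑ i, |x i|) ^ q * x j) =
      fun x => (|∑ i, x i| / ∑ i, |x i|) ^ q * x j := by
    funext x
    split_ifs with h
    · simp [h]
    · rfl
  rw [hf]
  refine ⟨1 + 2 * q * n, LipschitzWith.of_dist_le_mul fun x y => ?_⟩
  have hmul := abs_ratio_sub_ratio_mul_sum_abs_le x y
  have hr := abs_sum_div_sum_abs_mem_Icc x
  have hs := abs_sum_div_sum_abs_mem_Icc y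
  have hxj : |x j| ≤ ∑ i, |x i| :=
    Finset.single_le_sum (f := fun i => |x i|) (fun i _ => abs_nonneg _) (Finset.mem_univ j)
  have hsum := sum_abs_sub_le_card_mul_dist x y
  rw [Fintype.card_fin] at hsum
  simp only [Real.dist_eq]
  set r := |∑ i, x i| / ∑ i, |x i|
  set s := |∑ i, y i| / ∑ i, |y i|
  calc |r ^ q * x j - s ^ q * y j| = |s ^ q * (x j - y j) + (r ^ q - s ^ q) * x j| := by ring_nf
    _ ≤ s ^ q * |x j - y j| + |r ^ q - s ^ q| * |x j| := by
        refine (abs_add_le _ _).trans_eq ?_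
        rw [abs_mul, abs_mul, abs_of_nonneg (pow_nonneg hs.1 q)]
    _ ≤ 1 * dist x y + q * |r - s| * ∑ i, |x i| := by
        gcongr
        · exact pow_le_one₀ hs.1 hs.2
        · exact dist_le_pi_dist x y j
        · exact abs_pow_sub_pow_le_mul_of_mem_Icc hr hs q
    _ = dist x y + q * (|r - s| * ∑ i, |x i|) := by ring
    _ ≤ dist x y + q * (2 * (n * dist x y)) := by
        gcongr _ + _ * ?_
        exact hmul.trans (by gcongr)
    _ = ((1 + 2 * q * n : ℝ≥0) : ℝ) * dist x y := by push_cast; ring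
end
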